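/- Let S ⊆ ℝ^m be a semialgebraic set of dimension at least 2, in the sense that the Krull dimension of ℝ[x_1,…,x_m]/I(S) is at least 2, where I(S) is the ideal of all polynomials vanishing identically on S. Then there exist an integer k ≥ 1 and polynomials g_1, …, g_k ∈ ℝ[x_1,…,x_m] such that the closed convex hull of {(g_1(ξ),…,g_k(ξ)) : ξ ∈ S} in ℝ^k is not a spectrahedral shadow. -/

import Mathlib

/-- A set `K ⊆ ℝ^k` is a spectrahedral shadow if it is the feasible-region projection of a
symmetric linear matrix inequality. -/
def IsSpectrahedralShadow {k : ℕ} (K : Set (Fin k → ℝ)) : Prop :=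
  ∃ (d m : ℕ), 0 < d ∧ ∃ (A : Matrix (Fin d) (Fin d) ℝ)
    (B : Fin k → Matrix (Fin d) (Fin d) ℝ) (C : Fin m → Matrix (Fin d) (Fin d) ℝ),
    A.IsSymm ∧ (∀ i, (B i).IsSymm) ∧ (∀ j, (C j).IsSymm) ∧
    K = {ξ | ∃ η : Fin m → ℝ, (A + ∑ i, ξ i • B i + ∑ j, η j • C j).PosSemidef}

/-- A set `S ⊆ ℝ^n` is semialgebraic: a finite union of sets given by one polynomial
equation and finitely many strict polynomial inequalities. -/
def IsSemialgebraic {n : ℕ} (S : Set (Fin n → ℝ)) : Prop :=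
  ∃ (r : ℕ) (p : Fin r → MvPolynomial (Fin n) ℝ) (s : Fin r → ℕ)
    (q : (i : Fin r) → Fin (s i) → MvPolynomial (Fin n) ℝ),
    S = ⋃ i, {ξ | MvPolynomial.eval ξ (p i) = 0 ∧ ∀ j, 0 < MvPolynomial.eval ξ (q i j)}

/-- The ideal of polynomials vanishing identically on `S ⊆ ℝ^m`. -/
noncomputable def vanishingIdealOn (m : ℕ) (S : Set (Fin m → ℝ)) : Ideal (MvPolynomial (Fin m) ℝ) where
  carrier := {f | ∀ ξ ∈ S, MvPolynomial.eval ξ f = 0}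
  add_mem' := by
    intro f g hf hg ξ hξ
    simp [hf ξ hξ, hg ξ hξ]
  zero_mem' := by
    intro ξ hξ
    simp
  smul_mem' := by
    intro c f hf ξ hξ
    simp [hf ξ hξ]

/-- Krull dimension does not increase along integral extensions. -/
lemma ringKrullDim_le_of_isIntegral {R A : Type*} [CommRing R] [CommRing A] (f : R →+* A)
    (hf : f.IsIntegral) : ringKrullDim A ≤ ringKrullDim R := by
  algebraize [f]
  refine Order.krullDim_le_of_strictMono (PrimeSpectrum.comap f) fun P Q hPQ => ?_
  rw [← PrimeSpectrum.asIdeal_lt_asIdeal] at hPQ ⊢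
  have := P.isPrime
  exact Ideal.IsIntegral.comap_lt_comap hPQ

lemma exists_pair_of_two_le_ringKrullDim {m : ℕ} {S : Set (Fin m → ℝ)}
    (hdim : 2 ≤ ringKrullDim (MvPolynomial (Fin m) ℝ ⧸ vanishingIdealOn m S)) :
    ∃ p : Fin 2 → MvPolynomial (Fin m) ℝ, ∀ F : MvPolynomial (Fin 2) ℝ, F ≠ 0 →
      ∃ ξ ∈ S, MvPolynomial.eval (fun i => MvPolynomial.eval ξ (p i)) F ≠ 0 := by
  have hnt : Nontrivial (MvPolynomial (Fin m) ℝ ⧸ vanishingIdealOn m S) := by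
    by_contra h
    rw [not_nontrivial_iff_subsingleton] at h
    rw [ringKrullDim_eq_bot_of_subsingleton] at hdim
    simp at hdim
  obtain ⟨s, φ, hinj, hint⟩ := exists_integral_inj_algHom_of_fg ℝ
    (MvPolynomial (Fin m) ℝ ⧸ vanishingIdealOn m S)
  have hs : 2 ≤ s := by
    have h1 := hdim.trans (ringKrullDim_le_of_isIntegral _ hint)
    rw [MvPolynomial.ringKrullDim_of_isNoetherianRing, ringKrullDim_eq_zero_of_field] at h1
    simpa using h1
  choose p hp using fun i : Fin 2 =>
    Ideal.Quotient.mk_surjective (φ (MvPolynomial.X (Fin.castLE hs i)))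
  refine ⟨p, fun F hF => ?_⟩
  by_contra! hS
  have hmem : MvPolynomial.aeval p F ∈ vanishingIdealOn m S := by
    intro ξ hξ
    change MvPolynomial.aeval ξ (MvPolynomial.aeval p F) = 0
    rw [MvPolynomial.comp_aeval_apply]
    exact hS ξ hξ
  have hzero : φ (MvPolynomial.rename (Fin.castLE hs) F) = 0 := by
    rw [← Ideal.Quotient.eq_zero_iff_mem.mpr hmem, ← Ideal.Quotient.mkₐ_eq_mk ℝ,
      MvPolynomial.comp_aeval_apply, MvPolynomial.rename_eq_aeval, MvPolynomial.comp_aeval_apply]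
    simp [hp]
  rw [map_eq_zero_iff φ hinj] at hzero
  exact hF (MvPolynomial.rename_injective _ (Fin.castLE_injective hs) (by simpa using hzero))

/-- Along a formally étale extension, derivations into modules over the top ring extend. -/
lemma Derivation.exists_extension_of_formallyEtale {R S B : Type*} [CommRing R] [CommRing S]
    [CommRing B] [Algebra R S] [Algebra R B] [Algebra S B] [IsScalarTower R S B]
    [Algebra.FormallyEtale S B] (d : Derivation R S B) :
    ∃ D : Derivation R B B, ∀ s, D (algebraMap S B s) = d s := by
  let e := KaehlerDifferential.tensorKaehlerEquivOfFormallyEtale R S B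
  let l : TensorProduct S B (Ω[S⁄R]) →ₗ[B] B := d.liftKaehlerDifferential.liftBaseChange B
  refine ⟨(l ∘ₗ e.symm.toLinearMap).compDer (KaehlerDifferential.D R B), fun s => ?_⟩
  have h : e.symm (KaehlerDifferential.D R B (algebraMap S B s)) =
      TensorProduct.tmul S 1 (KaehlerDifferential.D R S s) :=
    KaehlerDifferential.tensorKaehlerEquivOfFormallyEtale_symm_D_algebraMap R S B s
  change l (e.symm (KaehlerDifferential.D R B (algebraMap S B s))) = d s
  rw [h, LinearMap.liftBaseChange_one_tmul, Derivation.liftKaehlerDifferential_comp_D]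

lemma exists_derivation_of_algebraicIndependent {K B ι : Type*} [Field K] [Field B] [CharZero K]
    [Algebra K B] {v : ι → B} (hv : AlgebraicIndependent K v) (i : ι) :
    ∃ D : Derivation K B B, D (v i) = 1 ∧ ∀ j, j ≠ i → D (v j) = 0 := by
  classical
  obtain ⟨t, hvt, ht⟩ := exists_isTranscendenceBasis_superset hv.coe_range
  let S := MvPolynomial t K
  let e := ht.1.aevalEquiv
  let _ : Algebra S B := (MvPolynomial.aeval (R := K) ((↑) : t → B)).toAlgebra
  have : IsScalarTower K S B := IsScalarTower.of_algebraMap_eq fun r => by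
    simp [S, RingHom.algebraMap_toAlgebra]
  have hinj : Function.Injective (algebraMap S B) := ht.1
  have : FaithfulSMul S B := (faithfulSMul_iff_algebraMap_injective S B).mpr hinj
  let _ : Algebra (FractionRing S) B := FractionRing.liftAlgebra S B
  have : IsScalarTower S (FractionRing S) B := inferInstance
  have : Algebra.IsAlgebraic S B := by
    have := ht.isAlgebraic
    exact Algebra.IsAlgebraic.ringHom_of_comp_eq (e.symm : Algebra.adjoin K (Set.range ((↑) : t → B)) →+* S)
      (RingHom.id B) e.symm.injective Function.surjective_id <| by
        ext a
        obtain ⟨b, rfl⟩ := e.surjective a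
        change MvPolynomial.aeval _ (e.symm (e b)) = ((e b : Algebra.adjoin K _) : B)
        rw [e.symm_apply_apply]
        exact (ht.1.algebraMap_aevalEquiv b).symm
  have : Algebra.IsAlgebraic (FractionRing S) B :=
    (IsFractionRing.comap_isAlgebraic_iff (A := S) (K := FractionRing S)).mp inferInstance
  have : CharZero S := inferInstance
  have : CharZero (FractionRing S) := IsFractionRing.charZero S
  have : Algebra.FormallyEtale (FractionRing S) B := Algebra.FormallyEtale.of_isSeparable _ _
  have : Algebra.FormallyEtale S (FractionRing S) := Algebra.FormallyEtale.of_isLocalization (nonZeroDivisors S)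
  have : Algebra.FormallyEtale S B := .comp S (FractionRing S) B
  let x : ι → t := fun j => ⟨v j, hvt ⟨j, rfl⟩⟩
  obtain ⟨D, hD⟩ := Derivation.exists_extension_of_formallyEtale (B := B)
    (MvPolynomial.mkDerivation K (fun a : t => if a = x i then (1 : B) else 0))
  have key : ∀ j, D (v j) = if x j = x i then 1 else 0 := fun j => by
    rw [← MvPolynomial.mkDerivation_X (R := K) (fun a : t => if a = x i then (1 : B) else 0), ← hD]
    simp [x, RingHom.algebraMap_toAlgebra]
  refine ⟨D, by simp [key], fun j hj => ?_⟩
  rw [key, if_neg]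
  exact fun h => hj (hv.injective (congrArg Subtype.val h))

/-- The coefficients of a product of bivariate polynomials or power series. -/
def boxConv {R : Type*} [CommRing R] (u v : ℕ × ℕ → R) (q : ℕ × ℕ) : R :=
  ∑ i ∈ Finset.HasAntidiagonal.antidiagonal q.1,
    ∑ j ∈ Finset.HasAntidiagonal.antidiagonal q.2, u (i.1, j.1) * v (i.2, j.2)

/-- The exponents of bivariate monomials of total degree at most `D`. -/
def expLE (D : ℕ) : Finset (ℕ × ℕ) :=
  (Finset.range (D + 1) ×ˢ Finset.range (D + 1)).filter fun q => q.1 + q.2 ≤ D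

@[simp] lemma mem_expLE {D : ℕ} {q : ℕ × ℕ} : q ∈ expLE D ↔ q.1 + q.2 ≤ D := by
  simp only [expLE, Finset.mem_filter, Finset.mem_product, Finset.mem_range]
  omega

/-- The coefficients of the scaled Motzkin form `X⁴Y² + X²Y⁴ - 3t²X²Y² + t⁶`. -/
def motzkinCoeff {R : Type*} [CommRing R] (t : R) (q : ℕ × ℕ) : R :=
  if q = (4, 2) ∨ q = (2, 4) then 1 else if q = (2, 2) then -3 * t ^ 2
    else if q = (0, 0) then t ^ 6 else 0

open PowerSeries in
/-- The Taylor expansion of ring elements along a derivation. -/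
noncomputable def Derivation.taylorFun {K B : Type*} [Field K] [Field B] [Algebra K B]
    (D : Derivation K B B) (b : B) : PowerSeries B :=
  PowerSeries.mk fun n => D^[n] b / n.factorial

section
variable {K B : Type*} [Field K] [Field B] [Algebra K B] (D : Derivation K B B)

lemma Derivation.coeff_taylorFun (b : B) (n : ℕ) :
    PowerSeries.coeff n (D.taylorFun b) = D^[n] b / n.factorial := by
  simp [taylorFun]

lemma Derivation.taylorFun_add (a b : B) :
    D.taylorFun (a + b) = D.taylorFun a + D.taylorFun b := by
  ext n
  rw [map_add, coeff_taylorFun, coeff_taylorFun, coeff_taylorFun, ← add_div, iterate_map_add]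

variable [CharZero B]

lemma Derivation.derivative_taylorFun (b : B) :
    PowerSeries.derivative B (D.taylorFun b) = D.taylorFun (D b) := by
  ext n
  rw [PowerSeries.coeff_derivative, coeff_taylorFun, coeff_taylorFun, Function.iterate_succ_apply,
    Nat.factorial_succ]
  have h1 : (n.factorial : B) ≠ 0 := by exact_mod_cast n.factorial_ne_zero
  have h2 : (n + 1 : B) ≠ 0 := by exact_mod_cast n.succ_ne_zero
  push_cast
  field_simp

lemma Derivation.taylorFun_mul (a b : B) :
    D.taylorFun (a * b) = D.taylorFun a * D.taylorFun b := by
  ext n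
  induction n generalizing a b with
  | zero => simp [PowerSeries.coeff_mul, coeff_taylorFun]
  | succ n ih =>
    have h2 : (n + 1 : B) ≠ 0 := by exact_mod_cast n.succ_ne_zero
    apply mul_right_cancel₀ h2
    rw [← PowerSeries.coeff_derivative, ← PowerSeries.coeff_derivative,
      Derivation.leibniz (PowerSeries.derivative B), derivative_taylorFun, derivative_taylorFun,
      derivative_taylorFun, D.leibniz, taylorFun_add]
    simp only [smul_eq_mul, map_add, ih]

/-- The Taylor expansion along a derivation, as a ring homomorphism. -/
noncomputable def Derivation.taylor : B →+* PowerSeries B where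
  toFun := D.taylorFun
  map_one' := by
    ext n
    cases n with
    | zero => simp [coeff_taylorFun]
    | succ n => simp [coeff_taylorFun, PowerSeries.coeff_one, iterate_map_zero]
  map_mul' := D.taylorFun_mul
  map_zero' := by ext n; simp [coeff_taylorFun, iterate_map_zero]
  map_add' := D.taylorFun_add

lemma Derivation.coeff_taylor (b : B) (n : ℕ) :
    PowerSeries.coeff n (D.taylor b) = D^[n] b / n.factorial :=
  D.coeff_taylorFun b n

lemma Derivation.taylor_of_apply_eq_zero {b : B} (h : D b = 0) :
    D.taylor b = PowerSeries.C b := by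
  ext n
  cases n with
  | zero => simp [coeff_taylor]
  | succ n => simp [coeff_taylor, h, iterate_map_zero]

lemma Derivation.taylor_of_apply_eq_one {b : B} (h : D b = 1) :
    D.taylor b = PowerSeries.C b + PowerSeries.X := by
  ext n
  rcases n with - | - | n
  · simp [coeff_taylor]
  · simp [coeff_taylor, h]
  · simp [coeff_taylor, h, iterate_map_zero, PowerSeries.coeff_X]
end

/-- Coefficients of a power series in two variables, presented as an iterated power series. -/
noncomputable def coeffTwo (B : Type*) [CommRing B] (q : ℕ × ℕ) :
    PowerSeries (PowerSeries B) →ₗ[B] B :=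
  PowerSeries.coeff (R := B) q.1 ∘ₗ (PowerSeries.coeff (R := PowerSeries B) q.2).restrictScalars B

lemma coeffTwo_mul {B : Type*} [CommRing B] (u v : PowerSeries (PowerSeries B)) (q : ℕ × ℕ) :
    coeffTwo B q (u * v) = boxConv (fun p => coeffTwo B p u) (fun p => coeffTwo B p v) q := by
  simp only [coeffTwo, boxConv, LinearMap.comp_apply, LinearMap.restrictScalars_apply,
    PowerSeries.coeff_mul, map_sum]
  exact Finset.sum_comm

/-- A ring homomorphism into bivariate power series translating two independent elements. -/
lemma exists_taylor_hom {K B : Type*} [Field K] [Field B] [CharZero K]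
    [Algebra K B] {v : Fin 2 → B} (hv : AlgebraicIndependent K v) :
    ∃ T : B →+* PowerSeries (PowerSeries B),
      (∀ r : K, T (algebraMap K B r) = PowerSeries.C (PowerSeries.C (algebraMap K B r))) ∧
      T (v 0) = PowerSeries.C (PowerSeries.C (v 0) + PowerSeries.X) ∧
      T (v 1) = PowerSeries.C (PowerSeries.C (v 1)) + PowerSeries.X := by
  have : CharZero B := Algebra.charZero_of_charZero K B
  obtain ⟨D, hD, hD'⟩ : ∃ D : Derivation K B B, D (v 0) = 1 ∧ ∀ j, j ≠ 0 → D (v j) = 0 :=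
    exists_derivation_of_algebraicIndependent hv 0
  obtain ⟨E, hE, hE'⟩ : ∃ D : Derivation K B B, D (v 1) = 1 ∧ ∀ j, j ≠ 1 → D (v j) = 0 :=
    exists_derivation_of_algebraicIndependent hv 1
  refine ⟨(PowerSeries.map D.taylor).comp E.taylor, fun r => ?_, ?_, ?_⟩
  · simp [Derivation.taylor_of_apply_eq_zero]
  · simp [E.taylor_of_apply_eq_zero (hE' 0 (by simp)), D.taylor_of_apply_eq_one hD]
  · simp [E.taylor_of_apply_eq_one hE, D.taylor_of_apply_eq_zero (hD' 1 (by simp))]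

/-- In a sum of squares, exponents beyond half the weighted degree of the sum do not occur. -/
lemma coeff_eq_zero_of_sum_boxConv {J : Type*} [Fintype J] {D : ℕ} {u : J → ℕ × ℕ → ℝ}
    (hu : ∀ j q, q ∉ expLE D → u j q = 0) (α β m : ℤ) (hβ : β ≠ 0)
    (h : ∀ q : ℕ × ℕ, m < α * q.1 + β * q.2 → ∑ j, boxConv (u j) (u j) q = 0)
    (j : J) (p : ℕ × ℕ) (hp : m < 2 * (α * p.1 + β * p.2)) : u j p = 0 := by
  classical
  by_contra hne
  let s := (expLE D).filter fun q => ∃ j, u j q ≠ 0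
  have hs : ∀ j q, u j q ≠ 0 → q ∈ s := fun j q hq => by
    rw [Finset.mem_filter]
    exact ⟨by_contra fun h' => hq (hu j q h'), j, hq⟩
  let ℓ : ℕ × ℕ → ℤ ×ₗ ℤ := fun q => toLex (α * q.1 + β * q.2, (q.1 : ℤ))
  obtain ⟨r, hrs, hr⟩ := s.exists_max_image ℓ ⟨p, hs j p hne⟩
  have hmax : ∀ j q, u j q ≠ 0 → ℓ q ≤ ℓ r := fun j q hq => hr q (hs j q hq)
  have hpr := hmax j p hne
  simp only [ℓ, Prod.Lex.toLex_le_toLex] at hpr hmax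
  have hconv : ∀ j, boxConv (u j) (u j) (2 * r.1, 2 * r.2) = u j r ^ 2 := fun j => by
    unfold boxConv
    rw [Finset.sum_eq_single (r.1, r.1), Finset.sum_eq_single (r.2, r.2)]
    · ring
    · rintro ⟨b, b'⟩ hb hne
      simp only [Finset.HasAntidiagonal.mem_antidiagonal] at hb
      by_contra h0
      have h1 := hmax j _ (left_ne_zero_of_mul h0)
      have h2 := hmax j _ (right_ne_zero_of_mul h0)
      simp only at h1 h2
      have hb1 : (b' : ℤ) = 2 * r.2 - b := by omega
      have hb' : (b : ℤ) - r.2 ≠ 0 := fun hb2 => hne (by ext <;> simp <;> omega)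
      rw [hb1] at h2
      have := mul_ne_zero hβ hb'
      rcases h1 with h1 | h1 <;> rcases h2 with h2 | h2 <;> exact this (by linarith)
    · simp; omega
    · rintro ⟨a, a'⟩ ha hne
      simp only [Finset.HasAntidiagonal.mem_antidiagonal] at ha
      refine Finset.sum_eq_zero ?_
      rintro ⟨b, b'⟩ hb
      simp only [Finset.HasAntidiagonal.mem_antidiagonal] at hb
      by_contra h0
      have h1 := hmax j _ (left_ne_zero_of_mul h0)
      have h2 := hmax j _ (right_ne_zero_of_mul h0)
      simp only at h1 h2
      have hb1 : (b' : ℤ) = 2 * r.2 - b := by omega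
      have ha1 : (a' : ℤ) = 2 * r.1 - a := by omega
      have ha' : (a : ℤ) ≠ r.1 := fun hb2 => hne (by ext <;> simp <;> omega)
      rw [hb1, ha1] at h2
      rcases h1 with h1 | h1 <;> rcases h2 with h2 | h2
      · linarith
      · linarith [h2.1]
      · linarith [h1.1]
      · exact ha' (by linarith [h1.2, h2.2])
    · simp; omega
  have h0 := h (2 * r.1, 2 * r.2) (by
    push_cast
    rcases hpr with hpr | hpr
    · linarith
    · linarith [hpr.1])
  simp only [hconv] at h0
  rw [Finset.sum_eq_zero_iff_of_nonneg fun _ _ => sq_nonneg _] at h0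
  obtain ⟨k, hk⟩ := (Finset.mem_filter.mp hrs).2
  exact hk (by simpa using h0 k (Finset.mem_univ k))

lemma boxConv_eq_zero_of_notMem {D : ℕ} {u : ℕ × ℕ → ℝ}
    (hu : ∀ q, q ∉ expLE D → u q = 0) {q : ℕ × ℕ} (hq : q ∉ expLE (2 * D)) :
    boxConv u u q = 0 := by
  refine Finset.sum_eq_zero fun i hi => Finset.sum_eq_zero fun j hj => ?_
  simp only [Finset.HasAntidiagonal.mem_antidiagonal] at hi hj
  simp only [mem_expLE, not_le] at hq
  rcases le_or_gt (i.1 + j.1) D with h | h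
  · rw [hu (i.2, j.2) (by simp; omega), mul_zero]
  · rw [hu (i.1, j.1) (by simp; omega), zero_mul]

/-- The Motzkin form is not a sum of squares. -/
lemma eq_zero_of_sum_boxConv_eq_motzkin {J : Type*} [Fintype J] {D : ℕ} (hD : 3 ≤ D)
    {u : J → ℕ × ℕ → ℝ} (hu : ∀ j q, q ∉ expLE D → u j q = 0) {σ : ℝ}
    (h : ∀ q ∈ expLE (2 * D), ∑ j, boxConv (u j) (u j) q = σ ^ 2 * motzkinCoeff 1 q) :
    σ = 0 ∧ ∀ j q, u j q = 0 := by
  have hall : ∀ q, ∑ j, boxConv (u j) (u j) q = σ ^ 2 * motzkinCoeff 1 q := fun q => by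
    by_cases hq : q ∈ expLE (2 * D)
    · exact h q hq
    · rw [Finset.sum_eq_zero fun j _ => boxConv_eq_zero_of_notMem (hu j) hq]
      obtain ⟨a, b⟩ := q
      simp only [mem_expLE, not_le] at hq
      have : motzkinCoeff (1 : ℝ) (a, b) = 0 := by
        simp only [motzkinCoeff, Prod.mk.injEq]
        rw [if_neg (by omega), if_neg (by omega), if_neg (by omega)]
      simp [this]
  have hM : ∀ q : ℕ × ℕ, (6 < q.1 + q.2 ∨ 2 * q.2 < q.1 ∨ 2 * q.1 < q.2) →
      motzkinCoeff (1 : ℝ) q = 0 := by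
    rintro ⟨a, b⟩ hq
    simp only [motzkinCoeff, Prod.mk.injEq]
    simp only at hq
    rw [if_neg (by omega), if_neg (by omega), if_neg (by omega)]
  have hz : ∀ j p, (3 < p.1 + p.2 ∨ 2 * p.2 < p.1 ∨ 2 * p.1 < p.2) → u j p = 0 := by
    rintro j p (hp | hp | hp)
    · exact coeff_eq_zero_of_sum_boxConv hu 1 1 6 (by norm_num)
        (fun q hq => by rw [hall, hM q (by omega), mul_zero]) j p (by omega)
    · exact coeff_eq_zero_of_sum_boxConv hu 1 (-2) 0 (by norm_num)
        (fun q hq => by rw [hall, hM q (by omega), mul_zero]) j p (by omega)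
    · exact coeff_eq_zero_of_sum_boxConv hu (-2) 1 0 (by norm_num)
        (fun q hq => by rw [hall, hM q (by omega), mul_zero]) j p (by omega)
  have hσ : σ = 0 := by
    have h22 := hall (2, 2)
    have hc : ∀ j, boxConv (u j) (u j) (2, 2) = u j (1, 1) ^ 2 := fun j => by
      have e : Finset.HasAntidiagonal.antidiagonal 2 = {(0, 2), (1, 1), (2, 0)} := by decide
      simp [boxConv, e, hz j (0, 2), hz j (0, 1), hz j (1, 0), hz j (2, 0), hz j (2, 2)]
      ring
    simp only [hc, motzkinCoeff] at h22
    norm_num at h22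
    have := Finset.sum_nonneg fun (j : J) (_ : j ∈ Finset.univ) => sq_nonneg (u j (1, 1))
    nlinarith
  refine ⟨hσ, fun j q => ?_⟩
  exact coeff_eq_zero_of_sum_boxConv hu 1 1 (-1) (by norm_num)
    (fun q _ => by rw [hall, hσ]; ring) j q (by omega)

lemma boxConv_smul {R : Type*} [CommRing R] (c : R) (u : ℕ × ℕ → R) (q : ℕ × ℕ) :
    boxConv (fun p => c * u p) (fun p => c * u p) q = c ^ 2 * boxConv u u q := by
  simp only [boxConv, Finset.mul_sum]
  exact Finset.sum_congr rfl fun _ _ => Finset.sum_congr rfl fun _ _ => by ring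

/-- Extension by zero of a coefficient array of bounded degree. -/
def extendExp {D : ℕ} (K : expLE D → ℝ) (q : ℕ × ℕ) : ℝ :=
  if h : q ∈ expLE D then K ⟨q, h⟩ else 0

lemma extendExp_of_mem {D : ℕ} (K : expLE D → ℝ) {q : ℕ × ℕ} (h : q ∈ expLE D) :
    extendExp K q = K ⟨q, h⟩ := dif_pos h

lemma extendExp_of_notMem {D : ℕ} (K : expLE D → ℝ) {q : ℕ × ℕ} (h : q ∉ expLE D) :
    extendExp K q = 0 := dif_neg h

lemma extendExp_restrict {D : ℕ} {u : ℕ × ℕ → ℝ} (hu : ∀ q, q ∉ expLE D → u q = 0) :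
    extendExp (fun q : expLE D => u q) = u := by
  funext q
  by_cases h : q ∈ expLE D
  · rw [extendExp_of_mem _ h]
  · rw [extendExp_of_notMem _ h, hu q h]

/-- Sums of squares of bounded degree stay away from the Motzkin form, quantitatively. -/
lemma exists_pos_le_dist_motzkin (J : Type*) [Fintype J] {D : ℕ} (hD : 3 ≤ D) :
    ∃ m₀ : ℝ, 0 < m₀ ∧ ∀ (u : J → ℕ × ℕ → ℝ), (∀ j q, q ∉ expLE D → u j q = 0) →
      m₀ ≤ ∑ q ∈ expLE (2 * D), |∑ j, boxConv (u j) (u j) q - motzkinCoeff 1 q| ∧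
      ∀ j q, m₀ * u j q ^ 2 ≤
        ∑ q ∈ expLE (2 * D), |∑ j, boxConv (u j) (u j) q - motzkinCoeff 1 q| := by
  classical
  let G : ℝ × (J → expLE D → ℝ) → ℝ := fun x => ∑ q ∈ expLE (2 * D),
    |∑ j, boxConv (extendExp (x.2 j)) (extendExp (x.2 j)) q - x.1 ^ 2 * motzkinCoeff 1 q|
  have hext : ∀ j q, Continuous fun x : ℝ × (J → expLE D → ℝ) => extendExp (x.2 j) q := by
    intro j q
    by_cases h : q ∈ expLE D
    · simp only [extendExp_of_mem _ h]; fun_prop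
    · simp only [extendExp_of_notMem _ h]; fun_prop
  have hG : Continuous G := by
    refine continuous_finsetSum _ fun q _ => Continuous.abs (Continuous.sub ?_ (by fun_prop))
    refine continuous_finsetSum _ fun j _ => ?_
    unfold boxConv
    refine continuous_finsetSum _ fun a _ => continuous_finsetSum _ fun b _ => ?_
    exact (hext _ _).mul (hext _ _)
  have hhom : ∀ (c : ℝ) (x : ℝ × (J → expLE D → ℝ)), G (c • x) = c ^ 2 * G x := fun c x => by
    simp only [G, Finset.mul_sum]
    refine Finset.sum_congr rfl fun q _ => ?_
    have h1 : ∀ j, extendExp ((c • x).2 j) = fun p => c * extendExp (x.2 j) p := fun j => by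
      funext p
      by_cases h : p ∈ expLE D
      · simp [extendExp_of_mem _ h]
      · simp [extendExp_of_notMem _ h]
    simp only [h1, boxConv_smul]
    rw [← abs_of_nonneg (sq_nonneg c), ← abs_mul, abs_of_nonneg (sq_nonneg c), mul_sub,
      Finset.mul_sum]
    congr 2
    simp
    ring
  have hpos : ∀ x : ℝ × (J → expLE D → ℝ), x ≠ 0 → 0 < G x := fun x hx => by
    have hnn : 0 ≤ G x := Finset.sum_nonneg fun _ _ => abs_nonneg _
    refine hnn.lt_of_ne fun h0 => hx ?_
    have h1 := (Finset.sum_eq_zero_iff_of_nonneg fun _ _ => abs_nonneg _).mp h0.symm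
    obtain ⟨hσ, hu⟩ := eq_zero_of_sum_boxConv_eq_motzkin hD
      (fun j _ => extendExp_of_notMem (x.2 j)) (σ := x.1)
      fun q hq => sub_eq_zero.mp (abs_eq_zero.mp (h1 q hq))
    refine Prod.ext hσ ?_
    funext j ⟨q, hq⟩
    rw [← extendExp_of_mem (x.2 j) hq, hu j q]
    rfl
  obtain ⟨x₀, hx₀, hmin⟩ := (isCompact_sphere (0 : ℝ × (J → expLE D → ℝ)) 1).exists_isMinOn
    ((NormedSpace.sphere_nonempty).mpr zero_le_one) hG.continuousOn
  have hx₀' : x₀ ≠ 0 := by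
    rintro rfl
    simp at hx₀
  have hle : ∀ x : ℝ × (J → expLE D → ℝ), G x₀ * ‖x‖ ^ 2 ≤ G x := fun x => by
    by_cases hx : x = 0
    · subst hx
      simpa using Finset.sum_nonneg fun _ _ => abs_nonneg _
    · have hn : ‖x‖ ≠ 0 := norm_ne_zero_iff.mpr hx
      have h1 : G x₀ ≤ G (‖x‖⁻¹ • x) := hmin (by simp [norm_smul, hn])
      rw [hhom] at h1
      calc G x₀ * ‖x‖ ^ 2 ≤ (‖x‖⁻¹ ^ 2 * G x) * ‖x‖ ^ 2 := by gcongr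
        _ = G x := by field_simp
  refine ⟨G x₀, hpos x₀ hx₀', fun u hu => ?_⟩
  have hGu : ∑ q ∈ expLE (2 * D), |∑ j, boxConv (u j) (u j) q - motzkinCoeff 1 q| =
      G (1, fun j q => u j q) := by
    simp only [G, extendExp_restrict (hu _), one_pow, one_mul]
  rw [hGu]
  have h1 := hle (1, fun j q => u j q)
  have h2 := hpos x₀ hx₀'
  have h3 : (1 : ℝ) ≤ ‖((1, fun j q => u j q) : ℝ × (J → expLE D → ℝ))‖ := by
    simp [Prod.norm_def]
  have h4 : ∀ j q, |u j q| ≤ ‖((1, fun j q => u j q) : ℝ × (J → expLE D → ℝ))‖ := fun j q => by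
    by_cases h : q ∈ expLE D
    · exact ((norm_le_pi_norm (fun q : expLE D => u j q) ⟨q, h⟩).trans
        (norm_le_pi_norm (fun j (q : expLE D) => u j q) j)).trans (le_max_right _ _)
    · rw [hu j q h, abs_zero]
      exact norm_nonneg _
  generalize G (1, fun j q => u j q) = y at *
  generalize ‖((1, fun j q => u j q) : ℝ × (J → expLE D → ℝ))‖ = n at *
  generalize G x₀ = z at *
  refine ⟨by nlinarith [one_le_pow₀ (n := 2) h3], fun j q => le_trans ?_ h1⟩
  rw [← sq_abs]
  gcongr
  exact h4 j q

lemma abs_boxConv_sub_le {a b : ℕ × ℕ → ℝ} {κ ε : ℝ} {D : ℕ} {q : ℕ × ℕ} (hq : q ∈ expLE D)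
    (ha : ∀ p ∈ expLE D, |a p| ≤ κ) (hb : ∀ p ∈ expLE D, |b p| ≤ κ)
    (hab : ∀ p ∈ expLE D, |a p - b p| ≤ ε * κ) :
    |boxConv a a q - boxConv b b q| ≤ (D + 1) ^ 2 * (2 * ε * κ ^ 2) := by
  rw [mem_expLE] at hq
  have hterm : ∀ i ∈ Finset.HasAntidiagonal.antidiagonal q.1,
      ∀ j ∈ Finset.HasAntidiagonal.antidiagonal q.2,
      |a (i.1, j.1) * a (i.2, j.2) - b (i.1, j.1) * b (i.2, j.2)| ≤ 2 * ε * κ ^ 2 := by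
    intro i hi j hj
    rw [Finset.HasAntidiagonal.mem_antidiagonal] at hi hj
    have h1 : (i.1, j.1) ∈ expLE D := by rw [mem_expLE]; simp only; omega
    have h2 : (i.2, j.2) ∈ expLE D := by rw [mem_expLE]; simp only; omega
    have hκ : 0 ≤ κ := (abs_nonneg _).trans (ha _ h1)
    calc _ = |(a (i.1, j.1) - b (i.1, j.1)) * a (i.2, j.2) +
          b (i.1, j.1) * (a (i.2, j.2) - b (i.2, j.2))| := by congr 1; ring
      _ ≤ ε * κ * κ + κ * (ε * κ) := by
          refine (abs_add_le _ _).trans ?_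
          rw [abs_mul, abs_mul]
          have := (abs_nonneg _).trans (hab _ h1)
          gcongr
          · exact hab _ h1
          · exact ha _ h2
          · exact hb _ h1
          · exact hab _ h2
      _ = _ := by ring
  have hc : 0 ≤ 2 * ε * κ ^ 2 :=
    (abs_nonneg _).trans (hterm (0, q.1) (by simp) (0, q.2) (by simp))
  unfold boxConv
  rw [← Finset.sum_sub_distrib]
  simp_rw [← Finset.sum_sub_distrib]
  calc _ ≤ ∑ i ∈ Finset.HasAntidiagonal.antidiagonal q.1,
        ∑ j ∈ Finset.HasAntidiagonal.antidiagonal q.2, 2 * ε * κ ^ 2 :=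
        (Finset.abs_sum_le_sum_abs _ _).trans <| Finset.sum_le_sum fun i hi =>
          (Finset.abs_sum_le_sum_abs _ _).trans <| Finset.sum_le_sum fun j hj => hterm i hi j hj
    _ = ((q.1 + 1 : ℕ) : ℝ) * ((q.2 + 1 : ℕ) : ℝ) * (2 * ε * κ ^ 2) := by
        simp only [Finset.sum_const, Finset.Nat.card_antidiagonal, nsmul_eq_mul]
        ring
    _ ≤ ((D + 1 : ℕ) : ℝ) * ((D + 1 : ℕ) : ℝ) * (2 * ε * κ ^ 2) := by
        gcongr <;> omega
    _ = _ := by push_cast; ring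

lemma boxConv_weight (t : ℝ) (u : ℕ × ℕ → ℝ) (q : ℕ × ℕ) :
    boxConv (fun p => t ^ (p.1 + p.2) / t ^ 3 * u p) (fun p => t ^ (p.1 + p.2) / t ^ 3 * u p) q =
      t ^ (q.1 + q.2) / t ^ 6 * boxConv u u q := by
  simp only [boxConv, Finset.mul_sum]
  refine Finset.sum_congr rfl fun i hi => Finset.sum_congr rfl fun j hj => ?_
  rw [Finset.HasAntidiagonal.mem_antidiagonal] at hi hj
  rw [← hi, ← hj, show i.1 + i.2 + (j.1 + j.2) = (i.1 + j.1) + (i.2 + j.2) by ring, pow_add]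
  ring

lemma motzkinCoeff_weight {t : ℝ} (ht : t ≠ 0) (q : ℕ × ℕ) :
    motzkinCoeff 1 q = t ^ (q.1 + q.2) / t ^ 6 * motzkinCoeff t q := by
  unfold motzkinCoeff
  split_ifs with h1 h2 h3
  · rcases h1 with rfl | rfl <;> field_simp
  · subst h2; field_simp
  · subst h3; field_simp; simp
  · simp

set_option maxHeartbeats 1000000 in
/-- If the coefficients of high degree are controlled linearly by those of low degree, then sums
of squares cannot approximate a sufficiently scaled Motzkin form up to twice that degree. -/
lemma exists_scaled_motzkin_not_approx (J : Type*) [Fintype J] {D : ℕ} (hD : 3 ≤ D)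
    (c : ℕ × ℕ → ℕ × ℕ → ℝ) :
    ∃ t > (0 : ℝ), ∃ ρ > (0 : ℝ), ∀ H : J → ℕ × ℕ → ℝ,
      (∀ j, ∀ q ∈ expLE (2 * D), q ∉ expLE D → H j q = ∑ p ∈ expLE D, c q p * H j p) →
      ¬ ∀ q ∈ expLE (2 * D), |∑ j, boxConv (H j) (H j) q - motzkinCoeff t q| ≤ ρ := by
  classical
  obtain ⟨m₀, hm₀, hm⟩ := exists_pos_le_dist_motzkin J hD
  set L : ℝ := ∑ q ∈ expLE (2 * D), ∑ p ∈ expLE D, |c q p| with hL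
  have hL0 : 0 ≤ L := Finset.sum_nonneg fun _ _ => Finset.sum_nonneg fun _ _ => abs_nonneg _
  set n : ℝ := ((expLE (2 * D)).card : ℝ) with hn
  have hn0 : 0 < n := by
    rw [hn]
    exact_mod_cast Finset.card_pos.mpr ⟨(0, 0), by simp⟩
  set N : ℝ := n * (Fintype.card J * (((2 * D : ℕ) + 1) ^ 2 * 2)) with hN
  have hN0 : 0 ≤ N := by positivity
  set t : ℝ := 1 / (1 + L + 2 * N * L / m₀) with ht
  have hden : 0 < 1 + L + 2 * N * L / m₀ := by positivity
  have ht0 : 0 < t := by positivity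
  have htden : t * (1 + L + 2 * N * L / m₀) = 1 := by rw [ht]; field_simp
  have hx0 : 0 ≤ t * (2 * N * L / m₀) := by positivity
  have hx1 : 0 ≤ t * L := by positivity
  have ht1 : t ≤ 1 := by nlinarith
  have htL : t * L ≤ 1 := by nlinarith
  have htN : N * (t * L) ≤ m₀ / 2 := by
    have h1 : t * (2 * N * L / m₀) ≤ 1 := by nlinarith
    have h2 : N * (t * L) = t * (2 * N * L / m₀) * (m₀ / 2) := by field_simp
    rw [h2]
    nlinarith
  clear_value t N n L
  refine ⟨t, ht0, t ^ 6 * m₀ / (4 * n), by positivity, fun H hH hcontra => ?_⟩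
  set K : J → ℕ × ℕ → ℝ := fun j p => t ^ (p.1 + p.2) / t ^ 3 * H j p with hK
  set u : J → ℕ × ℕ → ℝ := fun j p => if p ∈ expLE D then K j p else 0 with hu
  have hu0 : ∀ j q, q ∉ expLE D → u j q = 0 := fun j q hq => if_neg hq
  obtain ⟨hS1, hS2⟩ := hm u hu0
  set s := ∑ q ∈ expLE (2 * D), |∑ j, boxConv (u j) (u j) q - motzkinCoeff 1 q| with hs
  set κ := √(s / m₀) with hκ
  have hs0 : 0 ≤ s := hm₀.le.trans hS1
  clear_value s
  have hκs : m₀ * κ ^ 2 = s := by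
    rw [hκ, Real.sq_sqrt (by positivity)]
    field_simp
  have hκ0 : 0 ≤ κ := Real.sqrt_nonneg _
  have hκ1 : 1 ≤ κ ^ 2 := by nlinarith
  clear_value κ
  have huκ : ∀ j q, |u j q| ≤ κ := fun j q => hκ ▸ Real.abs_le_sqrt (by
    rw [le_div_iff₀ hm₀]
    linarith [hS2 j q])
  have hKhigh : ∀ j, ∀ q ∈ expLE (2 * D), q ∉ expLE D → |K j q| ≤ t * L * κ := by
    intro j q hq hqD
    have hqD' : D < q.1 + q.2 := by simpa using hqD
    have h1 : K j q = ∑ p ∈ expLE D, t ^ (q.1 + q.2 - (p.1 + p.2)) * (c q p * K j p) := by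
      simp only [hK]
      rw [hH j q hq hqD, Finset.mul_sum]
      refine Finset.sum_congr rfl fun p hp => ?_
      have hp' : p.1 + p.2 ≤ D := by simpa using hp
      rw [show t ^ (q.1 + q.2) = t ^ (q.1 + q.2 - (p.1 + p.2)) * t ^ (p.1 + p.2) by
        rw [← pow_add]; congr 1; omega]
      ring
    rw [h1]
    calc _ ≤ ∑ p ∈ expLE D, t * (|c q p| * κ) := by
          refine (Finset.abs_sum_le_sum_abs _ _).trans (Finset.sum_le_sum fun p hp => ?_)
          have hp' : p.1 + p.2 ≤ D := by simpa using hp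
          rw [abs_mul, abs_mul, abs_pow, abs_of_pos ht0]
          gcongr
          · exact pow_le_of_le_one ht0.le ht1 (by omega)
          · simpa [hu, hp'] using huκ j p
      _ = t * (∑ p ∈ expLE D, |c q p|) * κ := by
          rw [Finset.mul_sum, Finset.sum_mul]
          exact Finset.sum_congr rfl fun _ _ => by ring
      _ ≤ t * L * κ := by
          gcongr
          rw [hL]
          exact Finset.single_le_sum (f := fun q => ∑ p ∈ expLE D, |c q p|)
            (fun _ _ => Finset.sum_nonneg fun _ _ => abs_nonneg _) hq
  have hKκ : ∀ j, ∀ p ∈ expLE (2 * D), |K j p| ≤ κ := fun j p hp => by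
    by_cases h : p ∈ expLE D
    · have := huκ j p
      simp only [hu, if_pos h] at this
      exact this
    · exact (hKhigh j p hp h).trans (mul_le_of_le_one_left hκ0 htL)
  have hKu : ∀ j, ∀ p ∈ expLE (2 * D), |K j p - u j p| ≤ t * L * κ := fun j p hp => by
    by_cases h : p ∈ expLE D
    · simp only [hu, if_pos h, sub_self, abs_zero]
      positivity
    · simp only [hu, if_neg h, sub_zero]
      exact hKhigh j p hp h
  have hdiff : ∀ q ∈ expLE (2 * D), |∑ j, boxConv (u j) (u j) q - motzkinCoeff 1 q| ≤
      t ^ 6 * m₀ / (4 * n) / t ^ 6 +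
        Fintype.card J * (((2 * D : ℕ) + 1) ^ 2 * (2 * (t * L) * κ ^ 2)) := by
    intro q hq
    have h1 : |∑ j, boxConv (K j) (K j) q - motzkinCoeff 1 q| ≤ t ^ 6 * m₀ / (4 * n) / t ^ 6 := by
      simp only [hK, boxConv_weight]
      rw [motzkinCoeff_weight ht0.ne', ← Finset.mul_sum, ← mul_sub, abs_mul,
        abs_of_nonneg (by positivity), div_mul_eq_mul_div]
      gcongr
      calc _ ≤ 1 * _ := mul_le_mul_of_nonneg_right (pow_le_one₀ ht0.le ht1) (abs_nonneg _)
        _ ≤ _ := by rw [one_mul]; exact hcontra q hq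
    have h2 : |∑ j, boxConv (K j) (K j) q - ∑ j, boxConv (u j) (u j) q| ≤
        Fintype.card J * (((2 * D : ℕ) + 1) ^ 2 * (2 * (t * L) * κ ^ 2)) := by
      rw [← Finset.sum_sub_distrib]
      refine (Finset.abs_sum_le_sum_abs _ _).trans ?_
      refine (Finset.sum_le_card_nsmul _ _ _ fun j _ =>
        abs_boxConv_sub_le hq (hKκ j) (fun p _ => huκ j p) (hKu j)).trans ?_
      simp
    rw [abs_le] at h1 h2 ⊢
    constructor <;> linarith
  have hfin : s ≤ n * (t ^ 6 * m₀ / (4 * n) / t ^ 6 +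
      Fintype.card J * (((2 * D : ℕ) + 1) ^ 2 * (2 * (t * L) * κ ^ 2))) := by
    rw [hs]
    refine (Finset.sum_le_card_nsmul _ _ _ hdiff).trans ?_
    rw [nsmul_eq_mul, hn]
  have h3 : n * (t ^ 6 * m₀ / (4 * n) / t ^ 6 +
      Fintype.card J * (((2 * D : ℕ) + 1) ^ 2 * (2 * (t * L) * κ ^ 2))) =
      m₀ / 4 + N * (t * L) * κ ^ 2 := by
    rw [hN]
    field_simp
  rw [h3] at hfin
  nlinarith

open scoped Matrix MatrixOrder ComplexOrder in
lemma Matrix.PosSemidef.exists_eq_transpose_mul_self {n : Type*} [Fintype n]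
    {M : Matrix n n ℝ} (hM : M.PosSemidef) : ∃ R : Matrix n n ℝ, M = Rᵀ * R := by
  classical
  obtain ⟨R, rfl⟩ := CStarAlgebra.nonneg_iff_eq_star_mul_self.mp hM.nonneg
  exact ⟨R, by rw [Matrix.star_eq_conjTranspose, Matrix.conjTranspose_eq_transpose_of_trivial]⟩

open scoped Matrix in
/-- Approximate duality for linear matrix inequalities: an affine functional that is nonnegative
on the feasible region is a limit of functionals with an evident positivity certificate. -/
lemma exists_approx_certificate {n I : Type*} [Fintype n] [Fintype I] {A : Matrix n n ℝ}
    {E : I → Matrix n n ℝ} (hA : A.IsSymm) (hE : ∀ i, (E i).IsSymm)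
    (hne : ∃ z : I → ℝ, (A + ∑ i, z i • E i).PosSemidef) {a : ℝ} {b : I → ℝ}
    (h : ∀ z : I → ℝ, (A + ∑ i, z i • E i).PosSemidef → 0 ≤ a + ∑ i, b i * z i)
    {ρ : ℝ} (hρ : 0 < ρ) :
    ∃ (Z : Matrix n n ℝ) (c : ℝ), |(Zᵀ * Z * A).trace + c ^ 2 - a| ≤ ρ ∧
      ∀ i, |(Zᵀ * Z * E i).trace - b i| ≤ ρ := by
  classical
  let P : Set (ℝ × (I → ℝ)) := {x | ∃ W : Matrix n n ℝ, W.PosSemidef ∧ ∃ c : ℝ, 0 ≤ c ∧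
    x = ((W * A).trace + c, fun i => (W * E i).trace)}
  have hP : Convex ℝ P := by
    rintro _ ⟨W, hW, c, hc, rfl⟩ _ ⟨W', hW', c', hc', rfl⟩ α β hα hβ -
    refine ⟨α • W + β • W', (hW.smul hα).add (hW'.smul hβ), α * c + β * c', by positivity, ?_⟩
    ext
    · simp [Matrix.add_mul]; ring
    · simp [Matrix.add_mul]
  have hmem : (a, b) ∈ closure P := by
    by_contra hnot
    obtain ⟨f, u, hfP, hfu⟩ :=
      geometric_hahn_banach_closed_point hP.closure isClosed_closure hnot
    have hf0 : 0 < u := by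
      have := hfP 0 (subset_closure ⟨0, .zero, 0, le_rfl, by ext <;> simp⟩)
      simpa using this
    have hcone : ∀ W : Matrix n n ℝ, W.PosSemidef → ∀ c : ℝ, 0 ≤ c →
        f ((W * A).trace + c, fun i => (W * E i).trace) ≤ 0 := by
      intro W hW c hc
      by_contra! hpos
      set y := f ((W * A).trace + c, fun i => (W * E i).trace) with hy
      have := hfP ((((u / y) • W) * A).trace + u / y * c, fun i => (((u / y) • W) * E i).trace)
        (subset_closure ⟨(u / y) • W, hW.smul (by positivity), u / y * c, by positivity, rfl⟩)
      have h2 : (((((u / y) • W) * A).trace + u / y * c, fun i => (((u / y) • W) * E i).trace) :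
          ℝ × (I → ℝ)) = (u / y) • ((W * A).trace + c, fun i => (W * E i).trace) := by
        ext
        · simp; ring
        · simp
      rw [h2, map_smul, ← hy, smul_eq_mul, div_mul_cancel₀ _ hpos.ne'] at this
      exact lt_irrefl _ this
    let μ : ℝ := -f (1, 0)
    let z : I → ℝ := fun i => -f (0, Pi.single i 1)
    have hf : ∀ x y, f (x, y) = -(μ * x + ∑ i, y i * z i) := fun x y => by
      have : ((x, y) : ℝ × (I → ℝ)) = x • (1, 0) + ∑ i, y i • (0, Pi.single i 1) := by
        ext i
        · simp [Prod.fst_sum]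
        · simp [Prod.snd_sum, Finset.sum_apply, Pi.single_apply]
      rw [this, map_add, map_smul, map_sum]
      simp only [map_smul, smul_eq_mul, μ, z, mul_neg, Finset.sum_neg_distrib]
      ring
    have hμ : 0 ≤ μ := by
      have := hcone 0 .zero 1 zero_le_one
      simpa [hf] using this
    have hpsd : (μ • A + ∑ i, z i • E i).PosSemidef := by
      refine .of_dotProduct_mulVec_nonneg ?_ fun v => ?_
      · rw [Matrix.IsHermitian, Matrix.conjTranspose_eq_transpose_of_trivial]
        simp [Matrix.transpose_sum, hA.eq, (hE _).eq]
      · have h1 := hcone (Matrix.vecMulVec v v)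
          (by simpa using Matrix.posSemidef_vecMulVec_self_star v) 0 le_rfl
        rw [hf] at h1
        have h2 : ∀ M : Matrix n n ℝ, (Matrix.vecMulVec v v * M).trace = v ⬝ᵥ M *ᵥ v := fun M => by
          rw [Matrix.vecMulVec_mul, Matrix.trace_vecMulVec, Matrix.dotProduct_mulVec, dotProduct_comm]
        simp only [h2] at h1
        simp only [star_trivial, Matrix.add_mulVec, Matrix.sum_mulVec, Matrix.smul_mulVec,
          dotProduct_add, dotProduct_sum, dotProduct_smul, smul_eq_mul]
        simp only [mul_comm (z _)]
        linarith
    have hneg : μ * a + ∑ i, b i * z i < 0 := by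
      have := hf a b
      linarith
    obtain ⟨z₀, hz₀⟩ := hne
    have hε : ∀ ε : ℝ, 0 < ε → 0 ≤ (μ * a + ∑ i, b i * z i) + ε * (a + ∑ i, b i * z₀ i) := by
      intro ε hε
      have hpos : 0 < μ + ε := by positivity
      have h1 : (A + ∑ i, ((μ + ε)⁻¹ * (z i + ε * z₀ i)) • E i) =
          (μ + ε)⁻¹ • ((μ • A + ∑ i, z i • E i) + ε • (A + ∑ i, z₀ i • E i)) := by
        simp only [smul_add, Finset.smul_sum, smul_smul, mul_add, add_smul, Finset.sum_add_distrib]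
        have : ((μ + ε)⁻¹ * μ) • A + ((μ + ε)⁻¹ * ε) • A = A := by
          rw [← add_smul, ← mul_add, inv_mul_cancel₀ hpos.ne', one_smul]
        nth_rewrite 1 [← this]
        abel
      have h2 := h (fun i => (μ + ε)⁻¹ * (z i + ε * z₀ i)) (by
        rw [h1]
        exact (hpsd.add (hz₀.smul hε.le)).smul (by positivity))
      have h3 : (μ + ε) * (a + ∑ i, b i * ((μ + ε)⁻¹ * (z i + ε * z₀ i))) =
          (μ * a + ∑ i, b i * z i) + ε * (a + ∑ i, b i * z₀ i) := by
        have : ∀ i, b i * ((μ + ε)⁻¹ * (z i + ε * z₀ i)) =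
            (μ + ε)⁻¹ * (b i * z i + ε * (b i * z₀ i)) := fun i => by ring
        simp only [this, ← Finset.mul_sum, Finset.sum_add_distrib]
        field_simp
        ring
      rw [← h3]
      positivity
    have h1 := h z₀ hz₀
    set y := a + ∑ i, b i * z₀ i
    have h2 := hε (-(μ * a + ∑ i, b i * z i) / (y + 1) / 2) (by
      have := neg_pos.mpr hneg
      positivity)
    set x := μ * a + ∑ i, b i * z i
    have h3 : x + -x / (y + 1) / 2 * y < 0 := by
      have h4 : y / (y + 1) ≤ 1 := by rw [div_le_one (by positivity)]; linarith
      have : x + -x / (y + 1) / 2 * y = x * (1 - y / (y + 1) / 2) := by ring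
      rw [this]
      exact mul_neg_of_neg_of_pos hneg (by linarith)
    linarith
  obtain ⟨_, ⟨W, hW, c, hc, rfl⟩, hdist⟩ := Metric.mem_closure_iff.mp hmem ρ hρ
  obtain ⟨Z, rfl⟩ := hW.exists_eq_transpose_mul_self
  rw [Prod.dist_eq, max_lt_iff] at hdist
  refine ⟨Z, √c, ?_, fun i => ?_⟩
  · rw [Real.sq_sqrt hc, abs_sub_comm]
    exact hdist.1.le
  · have := (dist_le_pi_dist _ _ i).trans hdist.2.le
    rwa [abs_sub_comm]

/-- A field of generic germs: a quotient of the ring of real functions on `Y` in which the given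
functions become algebraically independent. -/
lemma exists_field_of_not_vanishing {Y ι : Type} (v : ι → Y → ℝ)
    (hv : ∀ F : MvPolynomial ι ℝ, F ≠ 0 → ∃ y, MvPolynomial.eval (fun i => v i y) F ≠ 0) :
    ∃ (B : Type) (_ : Field B) (_ : Algebra ℝ B) (π : (Y → ℝ) →ₐ[ℝ] B),
      Function.Surjective π ∧
      (∃ l : Filter Y, l.NeBot ∧ ∀ f g : Y → ℝ, π f = π g → ∀ᶠ y in l, f y = g y) ∧
      AlgebraicIndependent ℝ (fun i => π (v i)) := by
  let M : Submonoid (Y → ℝ) :=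
    (nonZeroDivisors (MvPolynomial ι ℝ)).map (MvPolynomial.aeval v : MvPolynomial ι ℝ →ₐ[ℝ] (Y → ℝ))
  have heval : ∀ (F : MvPolynomial ι ℝ) y,
      MvPolynomial.aeval v F y = MvPolynomial.eval (fun i => v i y) F := fun F y => by
    have := MvPolynomial.comp_aeval_apply (f := v) (Pi.evalAlgHom ℝ (fun _ : Y => ℝ) y) F
    exact this
  have hdisj : Disjoint ((⊥ : Ideal (Y → ℝ)) : Set (Y → ℝ)) M := by
    rw [Set.disjoint_left]
    rintro f hf ⟨F, hF, rfl⟩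
    obtain ⟨y, hy⟩ := hv F (nonZeroDivisors.ne_zero hF)
    refine hy ?_
    rw [← heval]
    exact congrFun (Ideal.mem_bot.mp hf) y
  obtain ⟨𝔭, hp, -, hpM⟩ := Ideal.exists_le_prime_disjoint ⊥ M hdisj
  have hmax : 𝔭.IsMaximal := by
    refine Ideal.isMaximal_iff.mpr ⟨hp.one_notMem, fun I f hI hf hfI => ?_⟩
    have h1 : f * (f * f⁻¹ - 1) = 0 := by
      funext y
      by_cases h : f y = 0 <;> simp [h]
    have h2 : f * f⁻¹ - 1 ∈ 𝔭 := (hp.mem_or_mem (h1 ▸ 𝔭.zero_mem)).resolve_left hf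
    have h3 := I.sub_mem (I.mul_mem_right f⁻¹ hfI) (hI h2)
    simpa using h3
  let _ : Field ((Y → ℝ) ⧸ 𝔭) := Ideal.Quotient.field 𝔭
  refine ⟨(Y → ℝ) ⧸ 𝔭, inferInstance, inferInstance, Ideal.Quotient.mkₐ ℝ 𝔭,
    Ideal.Quotient.mkₐ_surjective ℝ 𝔭,
    ⟨⨅ h : 𝔭, Filter.principal {y | (h : Y → ℝ) y = 0}, ?_, fun f g hfg => ?_⟩, ?_⟩
  · have : Nonempty Y := by
      obtain ⟨y, -⟩ := hv 1 one_ne_zero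
      exact ⟨y⟩
    refine Filter.iInf_neBot_of_directed (fun f g => ?_) fun h => ?_
    · refine ⟨⟨f * f + g * g, 𝔭.add_mem (𝔭.mul_mem_left _ f.2) (𝔭.mul_mem_left _ g.2)⟩, ?_, ?_⟩ <;>
        refine Filter.principal_mono.mpr fun y hy => ?_ <;>
        simp only [Set.mem_ofPred_eq, Pi.add_apply, Pi.mul_apply] at hy ⊢ <;>
        nlinarith [mul_self_nonneg ((f : Y → ℝ) y), mul_self_nonneg ((g : Y → ℝ) y)]
    · rw [Filter.principal_neBot_iff]
      by_contra! hcon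
      have h1 : (h : Y → ℝ) * (h : Y → ℝ)⁻¹ = 1 := by
        funext y
        have : (h : Y → ℝ) y ≠ 0 := fun hy => Set.notMem_empty y (hcon ▸ hy)
        simp [this]
      exact hp.one_notMem (h1 ▸ 𝔭.mul_mem_right _ h.2)
  · have h1 : f - g ∈ 𝔭 := Ideal.Quotient.eq.mp hfg
    refine Filter.mem_of_superset (Filter.mem_iInf_of_mem ⟨_, h1⟩ (Filter.mem_principal_self _)) ?_
    exact fun y hy => sub_eq_zero.mp hy
  · rw [algebraicIndependent_iff]
    intro F hF
    by_contra hF0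
    have h1 : MvPolynomial.aeval v F ∈ 𝔭 := by
      rw [← Ideal.Quotient.eq_zero_iff_mem, ← Ideal.Quotient.mkₐ_eq_mk ℝ,
        MvPolynomial.comp_aeval_apply]
      exact hF
    exact Set.disjoint_left.mp hpM h1 ⟨F, mem_nonZeroDivisors_of_ne_zero hF0, rfl⟩

/-- Countably many vectors in a finite-dimensional space depend linearly on finitely many. -/
lemma exists_expLE_linear_relations {B N : Type*} [Field B] [Finite N] (r : ℕ × ℕ → N → B)
    (D₀ : ℕ) : ∃ D, D₀ ≤ D ∧ ∃ c : ℕ × ℕ → ℕ × ℕ → B,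
      ∀ q n, r q n = ∑ p ∈ expLE D, c q p * r p n := by
  classical
  have hfg : (Submodule.span B (Set.range r)).FG := IsNoetherian.noetherian _
  obtain ⟨t, ht, hspan⟩ := Submodule.fg_span_iff_fg_span_finset_subset _ |>.mp hfg
  choose! e he using fun x (hx : x ∈ (t : Set (N → B))) => ht hx
  let D := D₀ + ∑ x ∈ t, ((e x).1 + (e x).2)
  have hD : ∀ q, r q ∈ Submodule.span B (r '' (expLE D : Set (ℕ × ℕ))) := fun q => by
    have h1 : r q ∈ Submodule.span B (Set.range r) := Submodule.subset_span ⟨q, rfl⟩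
    rw [hspan] at h1
    have hsub : (t : Set (N → B)) ⊆ r '' (expLE D : Set (ℕ × ℕ)) := fun x hx => by
      refine ⟨e x, ?_, he x hx⟩
      rw [Finset.mem_coe, mem_expLE]
      have := Finset.single_le_sum (f := fun x => (e x).1 + (e x).2) (fun _ _ => Nat.zero_le _) hx
      exact this.trans (Nat.le_add_left _ _)
    exact Submodule.span_mono hsub h1
  choose c hc using fun q => (Submodule.mem_span_image_finset_iff_exists_fun B).mp (hD q)
  refine ⟨D, Nat.le_add_right _ _, fun q p => if h : p ∈ expLE D then c q ⟨p, h⟩ else 0,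
    fun q n => ?_⟩
  rw [← hc q, ← Finset.sum_coe_sort (expLE D), Finset.sum_apply]
  exact Finset.sum_congr rfl fun p _ => by simp only [p.2, dite_true]; rfl

section
variable {R : Type*} [CommRing R]

/-- The coefficient of `X ^ a` in `(X - x) ^ n`. -/
def shiftCoeff (n a : ℕ) (x : R) : R := n.choose a * (-x) ^ (n - a)

lemma sum_shiftCoeff {n m : ℕ} (hn : n ≤ m) (x X : R) :
    ∑ a ∈ Finset.range (m + 1), shiftCoeff n a x * X ^ a = (X - x) ^ n := by
  rw [← Finset.sum_subset (Finset.range_mono (Nat.succ_le_succ hn)), sub_eq_add_neg, add_pow]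
  · exact Finset.sum_congr rfl fun a _ => by simp only [shiftCoeff]; ring
  · intro a _ ha
    rw [Finset.mem_range, not_lt] at ha
    simp [shiftCoeff, Nat.choose_eq_zero_of_lt ha]

/-- The scaled Motzkin form. -/
def motzkin (t X Y : R) : R := X ^ 4 * Y ^ 2 + X ^ 2 * Y ^ 4 - 3 * t ^ 2 * (X ^ 2 * Y ^ 2) + t ^ 6

/-- The coefficients of the scaled Motzkin form translated to the point `(x, y)`. -/
def motzkinShiftCoeff (t x y : R) (a b : ℕ) : R :=
  shiftCoeff 4 a x * shiftCoeff 2 b y + shiftCoeff 2 a x * shiftCoeff 4 b y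
    - 3 * t ^ 2 * (shiftCoeff 2 a x * shiftCoeff 2 b y) + t ^ 6 * (shiftCoeff 0 a x * shiftCoeff 0 b y)

lemma sum_motzkinShiftCoeff (t x y X Y : R) :
    ∑ a ∈ Finset.range 5, ∑ b ∈ Finset.range 5, motzkinShiftCoeff t x y a b * (X ^ a * Y ^ b) =
      motzkin t (X - x) (Y - y) := by
  have h : ∀ n k, n ≤ 4 → k ≤ 4 → (X - x) ^ n * (Y - y) ^ k =
      ∑ a ∈ Finset.range 5, ∑ b ∈ Finset.range 5,
        shiftCoeff n a x * shiftCoeff k b y * (X ^ a * Y ^ b) := fun n k hn hk => by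
    rw [← sum_shiftCoeff (m := 4) hn, ← sum_shiftCoeff (m := 4) hk, Finset.sum_mul_sum]
    exact Finset.sum_congr rfl fun _ _ => Finset.sum_congr rfl fun _ _ => by ring
  have h0 := h 0 0 (by simp) (by simp)
  rw [pow_zero, pow_zero, one_mul] at h0
  rw [motzkin, h 4 2 (by simp) (by simp), h 2 4 (by simp) (by simp), h 2 2 (by simp) (by simp),
    ← mul_one (t ^ 6), h0]
  simp only [Finset.mul_sum, ← Finset.sum_add_distrib, ← Finset.sum_sub_distrib, motzkinShiftCoeff]
  exact Finset.sum_congr rfl fun _ _ => Finset.sum_congr rfl fun _ _ => by ring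

lemma map_motzkinShiftCoeff {R' : Type*} [CommRing R'] (f : R →+* R') (t x y : R) (a b : ℕ) :
    f (motzkinShiftCoeff t x y a b) = motzkinShiftCoeff (f t) (f x) (f y) a b := by
  have h3 : f 3 = 3 := map_ofNat f 3
  simp [motzkinShiftCoeff, shiftCoeff, h3]
end

lemma motzkin_nonneg (t X Y : ℝ) : 0 ≤ motzkin t X Y := by
  have h : (X ^ 2 + Y ^ 2) ^ 2 * motzkin t X Y =
      X ^ 2 * Y ^ 2 * (X ^ 2 + Y ^ 2 + t ^ 2) * (X ^ 2 + Y ^ 2 - 2 * t ^ 2) ^ 2 +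
        (X ^ 2 - Y ^ 2) ^ 2 * t ^ 6 := by
    unfold motzkin
    ring
  rcases eq_or_lt_of_le (show 0 ≤ X ^ 2 + Y ^ 2 by positivity) with h0 | h0
  · have hX : X = 0 := by nlinarith [sq_nonneg Y]
    have ht : t ^ 6 = (t ^ 3) ^ 2 := by ring
    simp [motzkin, hX, ht, sq_nonneg]
  · refine nonneg_of_mul_nonneg_right (h ▸ ?_) (pow_pos h0 2)
    have ht : t ^ 6 = (t ^ 3) ^ 2 := by ring
    rw [ht]
    positivity

lemma coeffTwo_C_mul {B : Type*} [CommRing B] (b : B) (u : PowerSeries (PowerSeries B))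
    (q : ℕ × ℕ) : coeffTwo B q (PowerSeries.C (PowerSeries.C b) * u) = b * coeffTwo B q u := by
  simp [coeffTwo]

lemma coeffTwo_monomial {B : Type*} [CommRing B] (a b : ℕ) (q : ℕ × ℕ) :
    coeffTwo B q (PowerSeries.C PowerSeries.X ^ a * PowerSeries.X ^ b) =
      if q = (a, b) then 1 else 0 := by
  rw [← map_pow]
  simp only [coeffTwo, LinearMap.comp_apply, LinearMap.restrictScalars_apply,
    PowerSeries.coeff_C_mul, PowerSeries.coeff_X_pow, mul_ite, mul_one, mul_zero, Prod.ext_iff]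
  by_cases h1 : q.2 = b <;> by_cases h2 : q.1 = a <;> simp [h1, h2, PowerSeries.coeff_X_pow]

lemma coeffTwo_one {B : Type*} [CommRing B] (q : ℕ × ℕ) :
    coeffTwo B q 1 = if q = 0 then 1 else 0 := by
  simpa [Prod.zero_eq_mk] using coeffTwo_monomial (B := B) 0 0 q

lemma coeffTwo_motzkin {B : Type*} [CommRing B] (t : B) (q : ℕ × ℕ) :
    coeffTwo B q (motzkin (PowerSeries.C (PowerSeries.C t)) (PowerSeries.C PowerSeries.X)
      PowerSeries.X) = motzkinCoeff t q := by
  have h : motzkin (PowerSeries.C (PowerSeries.C t)) (PowerSeries.C PowerSeries.X) PowerSeries.X =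
      PowerSeries.C PowerSeries.X ^ 4 * PowerSeries.X ^ 2 +
      PowerSeries.C PowerSeries.X ^ 2 * PowerSeries.X ^ 4 +
      PowerSeries.C (PowerSeries.C (-3 * t ^ 2)) *
        (PowerSeries.C PowerSeries.X ^ 2 * PowerSeries.X ^ 2) +
      PowerSeries.C (PowerSeries.C (t ^ 6)) *
        (PowerSeries.C PowerSeries.X ^ 0 * PowerSeries.X ^ 0) := by
    have h3 : (PowerSeries.C (PowerSeries.C 3) : PowerSeries (PowerSeries B)) = 3 := by
      rw [map_ofNat, map_ofNat]
    simp only [motzkin, map_mul, map_neg, map_pow, h3]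
    ring
  rw [h, map_add, map_add, map_add, coeffTwo_C_mul, coeffTwo_C_mul]
  simp only [coeffTwo_monomial, motzkinCoeff]
  by_cases h1 : q = (4, 2)
  · subst h1; simp
  by_cases h2 : q = (2, 4)
  · subst h2; simp
  by_cases h3 : q = (2, 2)
  · subst h3; simp
  simp [h1, h2, h3]

lemma boxConv_sum_sum {R I : Type*} [CommRing R] [Fintype I] (u v : I → ℕ × ℕ → R) (z w : I → R)
    (q : ℕ × ℕ) : boxConv (fun p => ∑ i, u i p * z i) (fun p => ∑ j, v j p * w j) q =
      ∑ i, ∑ j, z i * w j * boxConv (u i) (v j) q := by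
  have hcomm : ∀ (s t : Finset (ℕ × ℕ)) (f : ℕ × ℕ → ℕ × ℕ → I → I → R),
      ∑ a ∈ s, ∑ b ∈ t, ∑ i, ∑ j, f a b i j = ∑ i, ∑ j, ∑ a ∈ s, ∑ b ∈ t, f a b i j :=
    fun s t f => by
      rw [Finset.sum_congr rfl fun a _ => Finset.sum_comm, Finset.sum_comm]
      refine Finset.sum_congr rfl fun i _ => ?_
      rw [Finset.sum_congr rfl fun a _ => Finset.sum_comm, Finset.sum_comm]
  simp only [boxConv, Finset.sum_mul_sum]
  rw [hcomm]
  simp only [Finset.mul_sum]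
  refine Finset.sum_congr rfl fun i _ => Finset.sum_congr rfl fun j _ =>
    Finset.sum_congr rfl fun a _ => Finset.sum_congr rfl fun b _ => ?_
  ring

lemma boxConv_one_one {R : Type*} [CommRing R] (c : R) (q : ℕ × ℕ) :
    boxConv (fun p => c * if p = 0 then 1 else 0) (fun p => c * if p = 0 then 1 else 0) q =
      c ^ 2 * if q = 0 then 1 else 0 := by
  have h : ∀ p : ℕ × ℕ, (c * if p = 0 then 1 else 0) =
    coeffTwo R p (PowerSeries.C (PowerSeries.C c) * 1) := fun p => by
      rw [coeffTwo_C_mul, coeffTwo_one]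
  simp only [h]
  rw [← coeffTwo_mul, mul_one, ← map_mul, ← map_mul, ← mul_one (PowerSeries.C _), coeffTwo_C_mul,
    coeffTwo_one, sq]

/-- The sum-of-squares expansion of the pairing of `Zᵀ * Z` with a Gram matrix, coefficientwise. -/
lemma sum_boxConv_eq_trace {R n I : Type*} [CommRing R] [Fintype n] [Fintype I]
    (A : Matrix n n R) (E : I → Matrix n n R) (Z : Matrix n n R) (u : n → n → ℕ × ℕ → R)
    (a : R) (ζ : I → R) (q : ℕ × ℕ)
    (h : ∀ i j, ∑ l, boxConv (u l i) (u l j) q = A i j * a + ∑ z, E z i j * ζ z) :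
    ∑ x : n × n, boxConv (fun p => ∑ i, u x.1 i p * Z x.2 i) (fun p => ∑ i, u x.1 i p * Z x.2 i) q =
      (Z.transpose * Z * A).trace * a + ∑ z, (Z.transpose * Z * E z).trace * ζ z := by
  let M : Matrix n n R := Matrix.of fun i j => ∑ l, boxConv (u l i) (u l j) q
  have hM : M = a • A + ∑ z, ζ z • E z := by
    ext i j
    simp only [M, Matrix.of_apply, h, Matrix.add_apply, Matrix.smul_apply, Matrix.sum_apply,
      smul_eq_mul, mul_comm]
  have htr : (Z.transpose * Z * M).trace =
      (Z.transpose * Z * A).trace * a + ∑ z, (Z.transpose * Z * E z).trace * ζ z := by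
    simp only [hM, Matrix.mul_add, Matrix.mul_sum, Matrix.mul_smul, Matrix.trace_add,
      Matrix.trace_sum, Matrix.trace_smul, smul_eq_mul, mul_comm]
  rw [← htr]
  simp only [boxConv_sum_sum, Fintype.sum_prod_type, Matrix.trace, Matrix.diag, Matrix.mul_apply,
    Matrix.transpose_apply, M, Matrix.of_apply, Finset.sum_mul_sum]
  calc ∑ l, ∑ k, ∑ i, ∑ j, Z k i * Z k j * boxConv (u l i) (u l j) q
      = ∑ k, ∑ i, ∑ j, ∑ l, Z k i * Z k j * boxConv (u l i) (u l j) q := by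
        rw [Finset.sum_comm]
        refine Finset.sum_congr rfl fun k _ => ?_
        rw [Finset.sum_comm]
        exact Finset.sum_congr rfl fun i _ => Finset.sum_comm
    _ = ∑ j, ∑ i, ∑ k, ∑ l, Z k i * Z k j * boxConv (u l i) (u l j) q := by
        rw [Finset.sum_congr rfl fun k _ => Finset.sum_comm, Finset.sum_comm]
        exact Finset.sum_congr rfl fun j _ => Finset.sum_comm
    _ = _ := by
        refine Finset.sum_congr rfl fun j _ => Finset.sum_congr rfl fun i _ =>
          Finset.sum_congr rfl fun k _ => Finset.sum_congr rfl fun l _ => ?_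
        ring

lemma map_motzkinCoeff {R R' : Type*} [CommRing R] [CommRing R'] (f : R →+* R') (t : R)
    (q : ℕ × ℕ) : f (motzkinCoeff t q) = motzkinCoeff (f t) q := by
  have h3 : f 3 = 3 := map_ofNat f 3
  unfold motzkinCoeff
  split_ifs <;> simp [h3]

lemma coeffTwo_C {B : Type*} [CommRing B] (b : B) (q : ℕ × ℕ) :
    coeffTwo B q (PowerSeries.C (PowerSeries.C b)) = b * coeffTwo B q 1 := by
  rw [← coeffTwo_C_mul, mul_one]

lemma map_fun_sum {Y A B ι : Type*} [CommRing A] [CommRing B] [Algebra A B]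
    (π : (Y → A) →ₐ[A] B) (s : Finset ι) (f : ι → Y → A) :
    π (fun y => ∑ x ∈ s, f x y) = ∑ x ∈ s, π (f x) := by
  rw [← map_sum]
  congr 1
  ext y
  rw [Finset.sum_apply]

/-- Coefficientwise consequences, at some point `y`, of a Gram identity between functions on `Y`. -/
lemma exists_specialized_expansion {Y : Type} (v : Fin 2 → Y → ℝ)
    (hv : ∀ F : MvPolynomial (Fin 2) ℝ, F ≠ 0 → ∃ y, MvPolynomial.eval (fun i => v i y) F ≠ 0)
    {n κ I : Type*} [Fintype n] [Fintype κ] [Fintype I] (e : κ ≃ Fin 5 × Fin 5)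
    (A : Matrix n n ℝ) (E : κ ⊕ I → Matrix n n ℝ) (z : κ ⊕ I → Y → ℝ)
    (hz : ∀ k y, z (.inl k) y = v 0 y ^ (e k).1.val * v 1 y ^ (e k).2.val)
    (R : Y → Matrix n n ℝ)
    (hR : ∀ y i j, ∑ l, R y l i * R y l j = A i j + ∑ x, E x i j * z x y)
    (τ : ℕ → (ℕ × ℕ → ℕ × ℕ → ℝ) → ℝ) :
    ∃ (D : ℕ) (c : ℕ × ℕ → ℕ × ℕ → ℝ) (y : Y) (u : n → n → ℕ × ℕ → ℝ)
      (ζ : κ ⊕ I → ℕ × ℕ → ℝ), 3 ≤ D ∧ ∀ q ∈ expLE (2 * D),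
        (∀ l i, u l i q = ∑ p ∈ expLE D, c q p * u l i p) ∧
        ((if q = 0 then 1 else 0) = ∑ p ∈ expLE D, c q p * if p = 0 then 1 else 0) ∧
        (∀ i j, ∑ l, boxConv (u l i) (u l j) q =
          A i j * (if q = 0 then 1 else 0) + ∑ x, E x i j * ζ x q) ∧
        ∑ k, motzkinShiftCoeff (τ D c) (v 0 y) (v 1 y) (e k).1 (e k).2 * ζ (.inl k) q =
          motzkinCoeff (τ D c) q := by
  obtain ⟨B, _, _, π, hπ, ⟨F, hF, hπF⟩, hind⟩ := exists_field_of_not_vanishing v hv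
  obtain ⟨T, hT, hT0, hT1⟩ := exists_taylor_hom hind
  obtain ⟨D, hD, C, hC⟩ := exists_expLE_linear_relations
    (fun q (x : (n × n) ⊕ Unit) => coeffTwo B q
      (x.elim (fun x => T (π fun y => R y x.1 x.2)) fun _ => 1)) 3
  choose σ hσ using hπ
  let c : Y → ℕ × ℕ → ℕ × ℕ → ℝ := fun y q p => σ (C q p) y
  let u : Y → n → n → ℕ × ℕ → ℝ := fun y l i q => σ (coeffTwo B q (T (π fun y => R y l i))) y
  let ζ : Y → κ ⊕ I → ℕ × ℕ → ℝ := fun y x q => σ (coeffTwo B q (T (π (z x)))) y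
  let t : Y → ℝ := fun y => τ D (c y)
  have hπc : ∀ q p, π (fun y => c y q p) = C q p := fun q p => hσ _
  have hπu : ∀ l i q, π (fun y => u y l i q) = coeffTwo B q (T (π fun y => R y l i)) :=
    fun l i q => hσ _
  have hπζ : ∀ x q, π (fun y => ζ y x q) = coeffTwo B q (T (π (z x))) := fun x q => hσ _
  have hconst : ∀ r : ℝ, π (fun _ => r) = algebraMap ℝ B r := fun r => π.commutes r
  suffices h : ∀ᶠ y in F, ∀ q ∈ expLE (2 * D),
        (∀ l i, u y l i q = ∑ p ∈ expLE D, c y q p * u y l i p) ∧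
        ((if q = 0 then 1 else 0) = ∑ p ∈ expLE D, c y q p * if p = 0 then 1 else 0) ∧
        (∀ i j, ∑ l, boxConv (u y l i) (u y l j) q =
          A i j * (if q = 0 then 1 else 0) + ∑ x, E x i j * ζ y x q) ∧
        ∑ k, motzkinShiftCoeff (t y) (v 0 y) (v 1 y) (e k).1 (e k).2 * ζ y (.inl k) q =
          motzkinCoeff (t y) q by
    obtain ⟨y, hy⟩ := h.exists
    exact ⟨D, c y, y, u y, ζ y, hD, hy⟩
  have hmul : ∀ f g : Y → ℝ, π (fun y => f y * g y) = π f * π g := fun f g => map_mul π f g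
  have hadd : ∀ f g : Y → ℝ, π (fun y => f y + g y) = π f + π g := fun f g => map_add π f g
  have hite : ∀ q : ℕ × ℕ, π (fun _ => if q = 0 then 1 else 0) = coeffTwo B q 1 := fun q => by
    rw [hconst, coeffTwo_one]
    split_ifs <;> simp
  rw [Filter.eventually_all_finset]
  intro q _
  refine .and ?_ (.and ?_ (.and ?_ ?_))
  · refine Filter.eventually_all.mpr fun l => Filter.eventually_all.mpr fun i => hπF _ _ ?_
    simp only [map_fun_sum, hmul, hπc, hπu]
    exact hC q (.inl (l, i))
  · refine hπF _ _ ?_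
    simp only [map_fun_sum, hmul, hπc, hite]
    exact hC q (.inr ())
  · refine Filter.eventually_all.mpr fun i => Filter.eventually_all.mpr fun j => hπF _ _ ?_
    simp only [boxConv, map_fun_sum, hadd, hmul, hπζ, hπu, hite, hconst]
    have h1 := congrArg (fun f => coeffTwo B q (T (π f))) (funext fun y => hR y i j)
    simp only [map_fun_sum, hadd, hmul, hconst, map_sum, map_add, map_mul, hT, coeffTwo_C_mul,
      coeffTwo_C] at h1
    simpa only [coeffTwo_mul, boxConv] using h1
  · refine hπF _ _ ?_
    have hshift : ∀ a b, π (fun y => motzkinShiftCoeff (t y) (v 0 y) (v 1 y) a b) =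
        motzkinShiftCoeff (π t) (π (v 0)) (π (v 1)) a b := fun a b => by
      rw [← AlgHom.coe_toRingHom, ← map_motzkinShiftCoeff]
      exact congrArg π <| funext fun y =>
        (map_motzkinShiftCoeff (Pi.evalRingHom (fun _ => ℝ) y) t (v 0) (v 1) a b).symm
    have hcoeff : π (fun y => motzkinCoeff (t y) q) = motzkinCoeff (π t) q := by
      rw [← AlgHom.coe_toRingHom, ← map_motzkinCoeff]
      exact congrArg π <| funext fun y =>
        (map_motzkinCoeff (Pi.evalRingHom (fun _ => ℝ) y) t q).symm
    have hzk : ∀ k, π (z (.inl k)) = π (v 0) ^ (e k).1.val * π (v 1) ^ (e k).2.val := fun k => by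
      rw [← map_pow, ← map_pow, ← map_mul]
      exact congrArg π (funext (hz k))
    let CC : B →+* PowerSeries (PowerSeries B) := PowerSeries.C.comp PowerSeries.C
    have hexp := sum_motzkinShiftCoeff (CC (π t)) (CC (π (v 0))) (CC (π (v 1)))
      (T (π (v 0))) (T (π (v 1)))
    have hX : T (π (v 0)) - CC (π (v 0)) = PowerSeries.C PowerSeries.X := by
      simp [hT0, CC]
    have hY : T (π (v 1)) - CC (π (v 1)) = PowerSeries.X := by
      simp [hT1, CC]
    rw [hX, hY] at hexp
    have h1 := congrArg (coeffTwo B q) hexp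
    rw [show CC (π t) = PowerSeries.C (PowerSeries.C (π t)) from rfl, coeffTwo_motzkin] at h1
    rw [map_fun_sum, hcoeff, ← h1]
    simp only [Finset.sum_range, map_sum]
    rw [← Fintype.sum_prod_type', ← e.sum_comp]
    refine Finset.sum_congr rfl fun k _ => ?_
    have hCC : PowerSeries.C (PowerSeries.C (π t)) = CC (π t) := rfl
    rw [hCC, hmul, hshift, hπζ, hzk, ← map_motzkinShiftCoeff CC, map_mul, map_pow, map_pow]
    exact (coeffTwo_C_mul _ _ _).symm

/-- A linear matrix inequality satisfied by the monomials in two independent functions does not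
force nonnegativity of all translated and scaled Motzkin forms. -/
lemma exists_posSemidef_and_motzkin_neg {Y : Type} (v : Fin 2 → Y → ℝ)
    (hv : ∀ F : MvPolynomial (Fin 2) ℝ, F ≠ 0 → ∃ y, MvPolynomial.eval (fun i => v i y) F ≠ 0)
    {n κ I : Type*} [Fintype n] [Fintype κ] [Fintype I] (e : κ ≃ Fin 5 × Fin 5)
    {A : Matrix n n ℝ} {E : κ ⊕ I → Matrix n n ℝ} (hA : A.IsSymm) (hE : ∀ x, (E x).IsSymm)
    (z : κ ⊕ I → Y → ℝ)
    (hz : ∀ k y, z (.inl k) y = v 0 y ^ (e k).1.val * v 1 y ^ (e k).2.val)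
    (hpsd : ∀ y, (A + ∑ x, z x y • E x).PosSemidef) :
    ∃ (t x y : ℝ) (w : κ ⊕ I → ℝ), (A + ∑ x, w x • E x).PosSemidef ∧
      ∑ k, motzkinShiftCoeff t x y (e k).1 (e k).2 * w (.inl k) < 0 := by
  by_contra! hcon
  choose R hR using fun y => (hpsd y).exists_eq_transpose_mul_self
  have hnot : ∀ (D : ℕ) (c : ℕ × ℕ → ℕ × ℕ → ℝ), ∃ t ρ : ℝ, 3 ≤ D → 0 < ρ ∧
      ∀ H : (n × n) ⊕ Unit → ℕ × ℕ → ℝ,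
        (∀ j, ∀ q ∈ expLE (2 * D), q ∉ expLE D → H j q = ∑ p ∈ expLE D, c q p * H j p) →
        ¬ ∀ q ∈ expLE (2 * D), |∑ j, boxConv (H j) (H j) q - motzkinCoeff t q| ≤ ρ :=
    fun D c => by
      by_cases hD : 3 ≤ D
      · obtain ⟨t, -, ρ, hρ, h⟩ := exists_scaled_motzkin_not_approx ((n × n) ⊕ Unit) hD c
        exact ⟨t, ρ, fun _ => ⟨hρ, h⟩⟩
      · exact ⟨0, 0, fun h => absurd h hD⟩
  choose τ ρ hτ using hnot
  obtain ⟨D, c, y, u, ζ, hD, h⟩ := exists_specialized_expansion v hv e A E z hz R (fun y i j => by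
    have := congrFun (congrFun (hR y) i) j
    simp only [Matrix.mul_apply, Matrix.transpose_apply, Matrix.add_apply, Matrix.sum_apply,
      Matrix.smul_apply, smul_eq_mul] at this
    simp only [← this, mul_comm]) τ
  obtain ⟨hρ, hnot⟩ := hτ D c hD
  let b : κ ⊕ I → ℝ := Sum.elim
    (fun k => motzkinShiftCoeff (τ D c) (v 0 y) (v 1 y) (e k).1 (e k).2) 0
  let L : ℝ := 1 + ∑ q ∈ expLE (2 * D), ∑ x, |ζ x q|
  have hL : 0 < L := by positivity
  obtain ⟨Z, r, hr, hZ⟩ := exists_approx_certificate (a := 0) (b := b) hA hE ⟨_, hpsd y⟩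
    (fun w hw => by simpa [b] using hcon (τ D c) (v 0 y) (v 1 y) w hw) (div_pos hρ hL)
  refine hnot (Sum.elim (fun x p => ∑ i, u x.1 i p * Z x.2 i)
    (fun _ p => r * if p = 0 then 1 else 0)) ?_ fun q hq => ?_
  · rintro (x | _) q hq -
    · simp only [Sum.elim_inl, (h q hq).1, Finset.sum_mul, Finset.mul_sum, mul_assoc]
      exact Finset.sum_comm
    · simp only [Sum.elim_inr, (h q hq).2.1, Finset.mul_sum, mul_left_comm]
  · obtain ⟨-, -, hgram, hmotzkin⟩ := h q hq
    simp only [Fintype.sum_sum_type, Sum.elim_inl, Sum.elim_inr, Finset.univ_unique,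
      Finset.sum_singleton]
    rw [sum_boxConv_eq_trace A E Z u _ (fun x => ζ x q) q hgram, boxConv_one_one, ← hmotzkin]
    have hb : ∑ k, motzkinShiftCoeff (τ D c) (v 0 y) (v 1 y) (e k).1 (e k).2 * ζ (.inl k) q =
        ∑ x, b x * ζ x q := by simp [b]
    have h1 : (Z.transpose * Z * A).trace * (if q = 0 then 1 else 0) +
        ∑ x, (Z.transpose * Z * E x).trace * ζ x q + r ^ 2 * (if q = 0 then 1 else 0) -
          ∑ x, b x * ζ x q =
        ((Z.transpose * Z * A).trace + r ^ 2 - 0) * (if q = 0 then 1 else 0) +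
          ∑ x, ((Z.transpose * Z * E x).trace - b x) * ζ x q := by
      simp only [sub_mul, Finset.sum_sub_distrib]
      ring
    rw [hb, h1]
    calc _ ≤ |((Z.transpose * Z * A).trace + r ^ 2 - 0) * (if q = 0 then 1 else 0)| +
          ∑ x, |((Z.transpose * Z * E x).trace - b x) * ζ x q| :=
        (abs_add_le _ _).trans (add_le_add_right (Finset.abs_sum_le_sum_abs _ _) _)
      _ ≤ ρ D c / L * 1 + ∑ x, ρ D c / L * |ζ x q| := by
        refine add_le_add ?_ (Finset.sum_le_sum fun x _ => ?_) <;> rw [abs_mul]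
        · refine mul_le_mul hr ?_ (abs_nonneg _) (by positivity)
          split_ifs <;> simp
        · exact mul_le_mul_of_nonneg_right (hZ x) (abs_nonneg _)
      _ = ρ D c / L * (1 + ∑ x, |ζ x q|) := by rw [mul_add, Finset.mul_sum]
      _ ≤ ρ D c / L * L := by
        refine mul_le_mul_of_nonneg_left (add_le_add_right ?_ 1) (by positivity)
        exact Finset.single_le_sum (f := fun q => ∑ x, |ζ x q|)
          (fun _ _ => Finset.sum_nonneg fun _ _ => abs_nonneg _) hq
      _ = ρ D c := div_mul_cancel₀ _ hL.ne'

theorem exists_polynomial_image_not_spectrahedralShadow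
    (m : ℕ) (S : Set (Fin m → ℝ)) (hS : IsSemialgebraic S)
    (hdim : 2 ≤ ringKrullDim (MvPolynomial (Fin m) ℝ ⧸ vanishingIdealOn m S)) :
    ∃ (k : ℕ), 1 ≤ k ∧ ∃ g : Fin k → MvPolynomial (Fin m) ℝ,
      ¬ IsSpectrahedralShadow
        (closure (convexHull ℝ ((fun ξ => fun i => MvPolynomial.eval ξ (g i)) '' S))) := by
  obtain ⟨p, hp⟩ := exists_pair_of_two_le_ringKrullDim hdim
  let e : Fin (5 * 5) ≃ Fin 5 × Fin 5 := finProdFinEquiv.symm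
  let g : Fin (5 * 5) → MvPolynomial (Fin m) ℝ :=
    fun k => p 0 ^ (e k).1.val * p 1 ^ (e k).2.val
  refine ⟨5 * 5, by norm_num, g, ?_⟩
  rintro ⟨d, l, -, A, B, C, hA, hB, hC, hK⟩
  have hmem : ∀ ξ : S, ∃ η : Fin l → ℝ, (A + ∑ i, MvPolynomial.eval ξ.1 (g i) • B i +
      ∑ j, η j • C j).PosSemidef := fun ξ =>
    hK.subset (subset_closure (subset_convexHull ℝ _ (Set.mem_image_of_mem _ ξ.2)))
  choose η hη using hmem
  obtain ⟨t, x, y, w, hw, hneg⟩ := exists_posSemidef_and_motzkin_neg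
    (fun i (ξ : S) => MvPolynomial.eval ξ.1 (p i))
    (fun F hF => by
      obtain ⟨ξ, hξ, h⟩ := hp F hF
      exact ⟨⟨ξ, hξ⟩, h⟩) e hA (E := Sum.elim B C) (by rintro (i | j) <;> simp [hB, hC])
    (Sum.elim (fun k ξ => MvPolynomial.eval ξ.1 (g k)) fun j ξ => η ξ j)
    (fun k ξ => by simp [g])
    (fun ξ => by simpa [← add_assoc] using hη ξ)
  rw [Fintype.sum_sum_type, ← add_assoc] at hw
  have hwK := hK.superset ⟨fun j => w (.inr j), hw⟩
  let f : Fin (5 * 5) → ℝ := fun k => motzkinShiftCoeff t x y (e k).1 (e k).2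
  let H : Set (Fin (5 * 5) → ℝ) := {u | 0 ≤ ∑ k, f k * u k}
  have hhalf : closure (convexHull ℝ ((fun ξ => fun i => MvPolynomial.eval ξ (g i)) '' S)) ⊆ H := by
    refine closure_minimal (convexHull_min ?_ ?_) ?_
    · rintro _ ⟨ξ, -, rfl⟩
      have h1 := sum_motzkinShiftCoeff t x y (MvPolynomial.eval ξ (p 0)) (MvPolynomial.eval ξ (p 1))
      simp only [Finset.sum_range] at h1
      rw [← Fintype.sum_prod_type', ← e.sum_comp] at h1
      change 0 ≤ ∑ k, f k * MvPolynomial.eval ξ (g k)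
      simp only [g, map_mul, map_pow]
      exact (motzkin_nonneg _ _ _).trans_eq h1.symm
    · rintro u hu v hv α β hα hβ -
      have h1 : ∑ k, f k * (α • u + β • v) k = α * ∑ k, f k * u k + β * ∑ k, f k * v k := by
        simp only [Finset.mul_sum, ← Finset.sum_add_distrib, Pi.add_apply, Pi.smul_apply,
          smul_eq_mul]
        exact Finset.sum_congr rfl fun k _ => by ring
      exact (add_nonneg (mul_nonneg hα hu) (mul_nonneg hβ hv)).trans_eq h1.symm
    · exact isClosed_le continuous_const
        (continuous_finsetSum _ fun k _ => continuous_const.mul (continuous_apply k))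
  exact absurd (hhalf hwK) (not_le.mpr hneg)
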